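/- Let A, B, C be three non-collinear points in ℝ² with dist A B = dist A C (an isosceles triangle with apex A and base BC). If P and Q are points of the convex hull of {A, B, C} with dist(P, line BC) = dist(Q, line BC) (in particular, if the segment PQ is parallel to the base BC), then V(P) = V(Q). Thus V is constant on each line segment inside the triangle parallel to the base. -/

import Mathlib

noncomputable def lineDist (P A B : EuclideanSpace ℝ (Fin 2)) : ℝ :=
  Metric.infDist P (affineSpan ℝ {A, B} : Set (EuclideanSpace ℝ (Fin 2)))

noncomputable def distSum (A B C P : EuclideanSpace ℝ (Fin 2)) : ℝ :=
  lineDist P A B + lineDist P B C + lineDist P C A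

/-- Twice the signed area of the triangle `A B P` in the Euclidean plane. -/
def doubleSignedArea (A B P : EuclideanSpace ℝ (Fin 2)) : ℝ :=
  (B 0 - A 0) * (P 1 - A 1) - (B 1 - A 1) * (P 0 - A 0)

lemma EuclideanSpace.dist_sq_fin_two (A B : EuclideanSpace ℝ (Fin 2)) :
    dist A B ^ 2 = (A 0 - B 0) ^ 2 + (A 1 - B 1) ^ 2 := by
  rw [EuclideanSpace.dist_eq, Real.sq_sqrt (by positivity)]
  simp [Fin.sum_univ_two, Real.dist_eq, sq_abs]

lemma lineDist_mul_dist {A B : EuclideanSpace ℝ (Fin 2)} (h : A ≠ B)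
    (P : EuclideanSpace ℝ (Fin 2)) :
    lineDist P A B * dist A B = |doubleSignedArea A B P| := by
  have hpos : 0 < dist A B := dist_pos.mpr h
  have hAB := EuclideanSpace.dist_sq_fin_two A B
  rw [← eq_div_iff hpos.ne']
  refine le_antisymm ?_ ?_
  · set t : ℝ := ((B 0 - A 0) * (P 0 - A 0) + (B 1 - A 1) * (P 1 - A 1)) / dist A B ^ 2 with ht
    refine (Metric.infDist_le_dist_of_mem
      (AffineMap.lineMap_mem_affineSpan_pair t A B)).trans ?_
    rw [le_div_iff₀ hpos]
    refine abs_le_of_sq_le_sq' ?_ (abs_nonneg _) |>.2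
    have ht' : t * dist A B ^ 2 =
        (B 0 - A 0) * (P 0 - A 0) + (B 1 - A 1) * (P 1 - A 1) := by
      rw [ht]; field_simp
    rw [mul_pow, sq_abs, EuclideanSpace.dist_sq_fin_two P, doubleSignedArea]
    simp only [AffineMap.lineMap_apply, vsub_eq_sub, vadd_eq_add, PiLp.add_apply,
      PiLp.smul_apply, PiLp.sub_apply, smul_eq_mul]
    rw [hAB] at ht' ⊢
    refine le_of_eq ?_
    linear_combination (t * ((A 0 - B 0) ^ 2 + (A 1 - B 1) ^ 2) -
      ((B 0 - A 0) * (P 0 - A 0) + (B 1 - A 1) * (P 1 - A 1))) * ht'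
  · refine (Metric.le_infDist ⟨A, left_mem_affineSpan_pair ℝ A B⟩).mpr fun X hX ↦ ?_
    obtain ⟨t, rfl⟩ := mem_affineSpan_pair_iff_exists_lineMap_eq.mp hX
    rw [div_le_iff₀ hpos]
    refine abs_le_of_sq_le_sq ?_ (by positivity)
    rw [mul_pow, hAB, EuclideanSpace.dist_sq_fin_two P, doubleSignedArea]
    simp only [AffineMap.lineMap_apply, vsub_eq_sub, vadd_eq_add, PiLp.add_apply,
      PiLp.smul_apply, PiLp.sub_apply, smul_eq_mul]
    nlinarith [sq_nonneg ((B 0 - A 0) * (P 0 - (t * (B 0 - A 0) + A 0)) +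
      (B 1 - A 1) * (P 1 - (t * (B 1 - A 1) + A 1)))]

lemma exists_weights_lineDist {A B C P : EuclideanSpace ℝ (Fin 2)}
    (hAB : A ≠ B) (hBC : B ≠ C) (hCA : C ≠ A)
    (hP : P ∈ convexHull ℝ ({A, B, C} : Set (EuclideanSpace ℝ (Fin 2)))) :
    ∃ a b c : ℝ, a + b + c = 1 ∧
      lineDist P A B * dist A B = c * |doubleSignedArea A B C| ∧
      lineDist P B C * dist B C = a * |doubleSignedArea A B C| ∧
      lineDist P C A * dist C A = b * |doubleSignedArea A B C| := by
  rw [convexHull_insert (Set.insert_nonempty _ _), convexHull_pair] at hP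
  simp only [convexJoin_singleton_left, Set.mem_iUnion] at hP
  obtain ⟨X, ⟨u, v, hu, hv, huv, rfl⟩, a, s, ha, hs, has, rfl⟩ := hP
  refine ⟨a, s * u, s * v, by linear_combination has + s * huv, ?_, ?_, ?_⟩
  · rw [lineDist_mul_dist hAB, ← abs_of_nonneg (mul_nonneg hs hv), ← abs_mul]
    obtain rfl : a = 1 - s := by linarith
    obtain rfl : u = 1 - v := by linarith
    congr 1
    simp [doubleSignedArea]
    ring
  · rw [lineDist_mul_dist hBC]
    nth_rw 2 [← abs_of_nonneg ha]
    rw [← abs_mul]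
    obtain rfl : s = 1 - a := by linarith
    obtain rfl : u = 1 - v := by linarith
    congr 1
    simp [doubleSignedArea]
    ring
  · rw [lineDist_mul_dist hCA, ← abs_of_nonneg (mul_nonneg hs hu), ← abs_mul]
    obtain rfl : a = 1 - s := by linarith
    obtain rfl : v = 1 - u := by linarith
    congr 1
    simp [doubleSignedArea]
    ring

theorem distSum_const_on_parallel_segment_isosceles
    (A B C : EuclideanSpace ℝ (Fin 2))
    (hncol : ¬ Collinear ℝ ({A, B, C} : Set (EuclideanSpace ℝ (Fin 2))))
    (hiso : dist A B = dist A C)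
    (P Q : EuclideanSpace ℝ (Fin 2))
    (hP : P ∈ convexHull ℝ ({A, B, C} : Set (EuclideanSpace ℝ (Fin 2))))
    (hQ : Q ∈ convexHull ℝ ({A, B, C} : Set (EuclideanSpace ℝ (Fin 2))))
    (hpar : lineDist P B C = lineDist Q B C) :
    distSum A B C P = distSum A B C Q := by
  have hAB : A ≠ B := ne₁₂_of_not_collinear hncol
  have hBC : B ≠ C := ne₂₃_of_not_collinear hncol
  have hCA : C ≠ A := (ne₁₃_of_not_collinear hncol).symm
  obtain ⟨a, b, c, h, h₁, h₂, h₃⟩ := exists_weights_lineDist hAB hBC hCA hP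
  obtain ⟨a', b', c', h', h₁', h₂', h₃'⟩ := exists_weights_lineDist hAB hBC hCA hQ
  rw [dist_comm C A, ← hiso] at h₃ h₃'
  have key : lineDist P A B + lineDist P C A = lineDist Q A B + lineDist Q C A := by
    refine mul_right_cancel₀ (dist_ne_zero.mpr hAB) ?_
    rw [hpar] at h₂
    linear_combination h₁ + h₃ - h₁' - h₃' + h₂ - h₂' + |doubleSignedArea A B C| * (h - h')
  unfold distSum
  linarith
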